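/- Assume in addition that Y is α-strongly convex for some α > 0. Fix μ > 0, τ ∈ (0,1], and run the R-PDCG iteration from (x₀,y₀) ∈ X×Y: s_k ∈ X with ⟨∇ₓ𝓛(x_k,y_k), s_k⟩ ≤ ⟨∇ₓ𝓛(x_k,y_k), x⟩ for all x ∈ X; x_{k+1} = τ·s_k + (1−τ)·x_k; g_k = ∇_y𝓛(x_k,y_k) − μ(y_k − y₀); p_k ∈ Y with ⟨g_k, p_k⟩ ≥ ⟨g_k, y⟩ for all y ∈ Y; σ_k = min{1, (α/(4(L_yy+μ)))·‖g_k‖}; y_{k+1} = σ_k·p_k + (1−σ_k)·y_k. Set E(τ) = L_yx·τ·D_Y·D_X + 2·L_xx·τ²·D_X². Then for every k ≥ 1, H(x_k,y_k) ≤ (9/(k+2)²)·max{H(x₀,y₀), 256·(L_yy+μ)²/(α²·μ)} + E(τ) + (8√2·(L_yy+μ)·E(τ)/(α√μ))^{2/3}. -/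

import Mathlib

open scoped RealInnerProductSpace

/-- Partial gradient of `L` in the first (primal) variable. -/
noncomputable def gradX {E F : Type*} [NormedAddCommGroup E] [InnerProductSpace ℝ E]
    [CompleteSpace E] (L : E → F → ℝ) (x : E) (y : F) : E :=
  gradient (fun x' => L x' y) x

/-- Partial gradient of `L` in the second (dual) variable. -/
noncomputable def gradY {E F : Type*} [NormedAddCommGroup F] [InnerProductSpace ℝ F]
    [CompleteSpace F] (L : E → F → ℝ) (x : E) (y : F) : F :=
  gradient (fun y' => L x y') y

/-- The regularized function `𝓛_μ(x,y) = 𝓛(x,y) − (μ/2)‖y − y₀‖²`. -/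
noncomputable def Lreg {E F : Type*} [NormedAddCommGroup F] [InnerProductSpace ℝ F]
    (L : E → F → ℝ) (μ : ℝ) (y₀ : F) (x : E) (y : F) : ℝ :=
  L x y - μ / 2 * ‖y - y₀‖ ^ 2

/-- Derivative of a function with a gradient along the segment joining two points. -/
theorem HasGradientAt.hasDerivAt_comp_lineMap {F : Type*} [NormedAddCommGroup F]
    [InnerProductSpace ℝ F] [CompleteSpace F] {f : F → ℝ} {y z g : F} {t : ℝ}
    (hg : HasGradientAt f g (AffineMap.lineMap y z t)) :
    HasDerivAt (fun t : ℝ => f (AffineMap.lineMap y z t)) ⟪g, z - y⟫ t := by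
  simpa [Function.comp_def] using hg.hasFDerivAt.comp_hasDerivAt t AffineMap.hasDerivAt_lineMap

/-- First-order (tangent) upper bound for a concave function. -/
theorem ConcaveOn.le_add_inner_of_hasGradientAt {F : Type*} [NormedAddCommGroup F]
    [InnerProductSpace ℝ F] [CompleteSpace F] {f : F → ℝ} (hf : ConcaveOn ℝ Set.univ f)
    {y g : F} (hg : HasGradientAt f g y) (z : F) : f z ≤ f y + ⟪g, z - y⟫ := by
  have hline : ConcaveOn ℝ Set.univ (fun t : ℝ => f (AffineMap.lineMap y z t)) := by
    simpa [Function.comp_def] using hf.comp_affineMap (AffineMap.lineMap y z : ℝ →ᵃ[ℝ] F)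
  have hderiv : HasDerivAt (fun t : ℝ => f (AffineMap.lineMap y z t)) ⟪g, z - y⟫ 0 :=
    HasGradientAt.hasDerivAt_comp_lineMap (by simpa using hg)
  have h := hline.slope_le_of_hasDerivAt (Set.mem_univ 0) (Set.mem_univ 1) one_pos hderiv
  simp [slope_def_field] at h
  linarith

/-- Quadratic lower bound for a function with Lipschitz gradient on a convex set. -/
theorem le_of_lipschitz_gradient {F : Type*} [NormedAddCommGroup F]
    [InnerProductSpace ℝ F] [CompleteSpace F] {f : F → ℝ} {G : F → F} {Y : Set F} {M : ℝ}
    (hY : Convex ℝ Y) (hG : ∀ y ∈ Y, HasGradientAt f (G y) y)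
    (hlip : ∀ y ∈ Y, ∀ z ∈ Y, ‖G y - G z‖ ≤ M * ‖y - z‖)
    {y z : F} (hy : y ∈ Y) (hz : z ∈ Y) :
    f y + ⟪G y, z - y⟫ - M / 2 * ‖z - y‖ ^ 2 ≤ f z := by
  have hmem : ∀ t ∈ Set.Icc (0 : ℝ) 1, AffineMap.lineMap y z t ∈ Y := fun t ht =>
    hY.lineMap_mem hy hz ht
  have hderiv : ∀ t ∈ Set.Icc (0 : ℝ) 1, HasDerivAt
      (fun t : ℝ => f (AffineMap.lineMap y z t) - t * ⟪G y, z - y⟫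
        + M / 2 * t ^ 2 * ‖z - y‖ ^ 2)
      (⟪G (AffineMap.lineMap y z t), z - y⟫ - ⟪G y, z - y⟫ + M * t * ‖z - y‖ ^ 2) t := by
    intro t ht
    have h1 := (hG _ (hmem t ht)).hasDerivAt_comp_lineMap
    have h2 := (hasDerivAt_id t).mul_const ⟪G y, z - y⟫
    have h3 := (((hasDerivAt_id t).pow 2).const_mul (M / 2)).mul_const (‖z - y‖ ^ 2)
    refine ((h1.sub h2).add h3).congr_deriv ?_
    simp only [id, Nat.cast_ofNat]
    ring
  have hmono := monotoneOn_of_hasDerivWithinAt_nonneg (convex_Icc (0 : ℝ) 1)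
    (fun t ht => (hderiv t ht).continuousAt.continuousWithinAt)
    (fun t ht => (hderiv t (interior_subset ht)).hasDerivWithinAt)
    (by
      intro t ht
      have ht' := interior_subset ht
      have h1 := hlip _ (hmem t ht') y hy
      have h2 : ‖(AffineMap.lineMap y z : ℝ →ᵃ[ℝ] F) t - y‖ = t * ‖z - y‖ := by
        rw [AffineMap.lineMap_apply, vsub_eq_sub, vadd_eq_add, add_sub_cancel_right, norm_smul,
          Real.norm_of_nonneg ht'.1]
      rw [h2] at h1
      have h3 := neg_le_of_abs_le
        (abs_real_inner_le_norm (G ((AffineMap.lineMap y z : ℝ →ᵃ[ℝ] F) t) - G y) (z - y))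
      have h4 := mul_le_mul_of_nonneg_right h1 (norm_nonneg (z - y))
      rw [inner_sub_left] at h3
      nlinarith)
  have h := hmono (Set.left_mem_Icc.2 zero_le_one) (Set.right_mem_Icc.2 zero_le_one) zero_le_one
  simp at h
  linarith

/-- A linear functional grows quadratically away from its maximizer over a strongly convex set. -/
theorem norm_mul_sq_le_inner_of_stronglyConvex {F : Type*} [NormedAddCommGroup F]
    [InnerProductSpace ℝ F] {Y : Set F} {α : ℝ}
    (hY : ∀ u ∈ Y, ∀ v ∈ Y, ∀ γ ∈ Set.Icc (0 : ℝ) 1, ∀ w : F, ‖w‖ = 1 →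
      γ • u + (1 - γ) • v + (γ * (1 - γ) * (α / 2) * ‖u - v‖ ^ 2) • w ∈ Y)
    {g p y : F} (hp : p ∈ Y) (hmax : ∀ z ∈ Y, ⟪g, z⟫ ≤ ⟪g, p⟫) (hy : y ∈ Y) :
    α / 4 * ‖g‖ * ‖p - y‖ ^ 2 ≤ ⟪g, p - y⟫ := by
  rcases eq_or_ne g 0 with rfl | hg
  · simp
  have hg' : ‖g‖ ≠ 0 := norm_ne_zero_iff.2 hg
  have h := hmax _ (hY p hp y hy (1 / 2) (by norm_num) (‖g‖⁻¹ • g)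
    (by rw [norm_smul, norm_inv, norm_norm, inv_mul_cancel₀ hg']))
  simp only [inner_add_right, inner_smul_right, real_inner_self_eq_norm_sq] at h
  have h2 : ‖g‖⁻¹ * ‖g‖ ^ 2 = ‖g‖ := by field_simp
  rw [h2] at h
  rw [inner_sub_right]
  linarith

/-- The gradient dominates the optimality gap of a strongly concave function. -/
theorem two_mul_le_norm_sq_of_strong_tangent {F : Type*} [NormedAddCommGroup F]
    [InnerProductSpace ℝ F] {μ D : ℝ} {g d : F} (hμ : 0 < μ)
    (h : D ≤ ⟪g, d⟫ - μ / 2 * ‖d‖ ^ 2) : 2 * μ * D ≤ ‖g‖ ^ 2 := by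
  have h1 := real_inner_le_norm g d
  have h2 : D ≤ ‖g‖ * ‖d‖ - μ / 2 * ‖d‖ ^ 2 := by linarith
  nlinarith [sq_nonneg (‖g‖ - μ * ‖d‖), mul_le_mul_of_nonneg_left h2 hμ.le]

/-- Over an `α`-strongly convex set, points are within `4 / α` of a maximizer of a nonzero
linear functional. -/
theorem mul_norm_sub_le_four_of_stronglyConvex {F : Type*} [NormedAddCommGroup F]
    [InnerProductSpace ℝ F] {Y : Set F} {α : ℝ}
    (hY : ∀ u ∈ Y, ∀ v ∈ Y, ∀ γ ∈ Set.Icc (0 : ℝ) 1, ∀ w : F, ‖w‖ = 1 →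
      γ • u + (1 - γ) • v + (γ * (1 - γ) * (α / 2) * ‖u - v‖ ^ 2) • w ∈ Y)
    {g p y : F} (hg : 0 < ‖g‖) (hp : p ∈ Y) (hmax : ∀ z ∈ Y, ⟪g, z⟫ ≤ ⟪g, p⟫) (hy : y ∈ Y) :
    α * ‖p - y‖ ≤ 4 := by
  have h1 := norm_mul_sq_le_inner_of_stronglyConvex hY hp hmax hy
  have h2 := h1.trans (real_inner_le_norm g (p - y))
  rcases (norm_nonneg (p - y)).eq_or_lt with h0 | h0
  · rw [← h0]; norm_num
  · have h3 : (‖g‖ * ‖p - y‖) * (α * ‖p - y‖) ≤ (‖g‖ * ‖p - y‖) * 4 := by linarith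
    exact le_of_mul_le_mul_left h3 (mul_pos hg h0)

/-- One conditional-gradient step with the adaptive step size on a strongly convex set. -/
theorem condGrad_step_of_stronglyConvex {F : Type*} [NormedAddCommGroup F]
    [InnerProductSpace ℝ F] [CompleteSpace F] {f : F → ℝ} {G : F → F} {Y : Set F} {M μ α : ℝ}
    (hYconv : Convex ℝ Y)
    (hY : ∀ u ∈ Y, ∀ v ∈ Y, ∀ γ ∈ Set.Icc (0 : ℝ) 1, ∀ w : F, ‖w‖ = 1 →
      γ • u + (1 - γ) • v + (γ * (1 - γ) * (α / 2) * ‖u - v‖ ^ 2) • w ∈ Y)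
    (hμ : 0 < μ) (hμM : μ ≤ M) (hα : 0 < α)
    (hG : ∀ y, HasGradientAt f (G y) y)
    (hstrong : ∀ y z, f z ≤ f y + ⟪G y, z - y⟫ - μ / 2 * ‖z - y‖ ^ 2)
    (hlip : ∀ y ∈ Y, ∀ z ∈ Y, ‖G y - G z‖ ≤ M * ‖y - z‖)
    {y z p y' : F} (hy : y ∈ Y) (hz : z ∈ Y) (hzmax : ∀ u ∈ Y, f u ≤ f z)
    (hp : p ∈ Y) (hmax : ∀ u ∈ Y, ⟪G y, u⟫ ≤ ⟪G y, p⟫)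
    (hy' : y' = (min 1 (α / (4 * M) * ‖G y‖)) • p + (1 - min 1 (α / (4 * M) * ‖G y‖)) • y) :
    y' ∈ Y ∧
    ((f z - f y' ≤ (f z - f y) / 2 ∧ f z - f y' ≤ 16 * M ^ 2 / (α ^ 2 * μ)) ∨
      f z - f y' ≤ (f z - f y)
        - α * √2 * √μ / (8 * M) * ((f z - f y) * √(f z - f y))) := by
  have hM : 0 < M := hμ.trans_le hμM
  set σ := min 1 (α / (4 * M) * ‖G y‖)
  have hσ0 : 0 ≤ σ := le_min zero_le_one (by positivity)
  have hσ1 : σ ≤ 1 := min_le_left _ _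
  have hy'Y : y' ∈ Y := by
    rw [hy']; exact hYconv hp hy hσ0 (by linarith) (by ring)
  refine ⟨hy'Y, ?_⟩
  have hsub : y' - y = σ • (p - y) := by rw [hy']; module
  have hdesc := le_of_lipschitz_gradient hYconv (fun u _ => hG u) hlip hy hy'Y
  rw [hsub, inner_smul_right, norm_smul, Real.norm_of_nonneg hσ0] at hdesc
  have hgrow := norm_mul_sq_le_inner_of_stronglyConvex hY hp hmax hy
  have hσM : M * σ ≤ α / 4 * ‖G y‖ := by
    calc M * σ ≤ M * (α / (4 * M) * ‖G y‖) :=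
          mul_le_mul_of_nonneg_left (min_le_right _ _) hM.le
      _ = α / 4 * ‖G y‖ := by field_simp
  have hgap := hstrong y z
  have hD0 : 0 ≤ f z - f y := sub_nonneg.2 (hzmax y hy)
  have hDinner : f z - f y ≤ ⟪G y, p - y⟫ := by
    have h1 := hmax z hz
    rw [inner_sub_right] at hgap ⊢
    nlinarith [sq_nonneg ‖z - y‖]
  have hquad : M / 2 * (σ * ‖p - y‖) ^ 2 ≤ σ / 2 * ⟪G y, p - y⟫ := by
    have h1 : M * σ * ‖p - y‖ ^ 2 ≤ ⟪G y, p - y⟫ :=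
      (mul_le_mul_of_nonneg_right hσM (sq_nonneg _)).trans hgrow
    nlinarith [mul_le_mul_of_nonneg_left h1 hσ0]
  have hdec : f z - f y' ≤ (f z - f y) - σ / 2 * (f z - f y) := by
    nlinarith [mul_le_mul_of_nonneg_left hDinner hσ0]
  rcases le_total 1 (α / (4 * M) * ‖G y‖) with hcase | hcase
  · left
    have hσ_eq : σ = 1 := min_eq_left hcase
    rw [hσ_eq] at hdec hsub
    refine ⟨by linarith, ?_⟩
    have hy'p : y' = p := by rw [hy', hσ_eq]; simp
    have hg : 0 < ‖G y‖ := by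
      rcases (norm_nonneg (G y)).eq_or_lt with h0 | h0
      · rw [← h0] at hcase; norm_num at hcase
      · exact h0
    have h1 := mul_norm_sub_le_four_of_stronglyConvex hY hg hp hmax hy
    have h2 := mul_norm_sub_le_four_of_stronglyConvex hY hg hp hmax hz
    have h3 := hstrong p z
    have h4 := (real_inner_le_norm (G p - G y) (z - p)).trans
      (mul_le_mul_of_nonneg_right (hlip p hp y hy) (norm_nonneg _))
    have h5 := hmax z hz
    rw [inner_sub_left, inner_sub_right (G y), norm_sub_rev z p] at h4
    have h6 : f z - f p ≤ M * ‖p - y‖ * ‖p - z‖ := by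
      nlinarith [sq_nonneg ‖z - p‖]
    have h7 : (α * ‖p - y‖) * (α * ‖p - z‖) ≤ 4 * 4 :=
      mul_le_mul h1 h2 (by positivity) (by norm_num)
    rw [hy'p, le_div_iff₀ (by positivity)]
    calc (f z - f p) * (α ^ 2 * μ) ≤ (M * ‖p - y‖ * ‖p - z‖) * (α ^ 2 * μ) := by gcongr
      _ = M * μ * ((α * ‖p - y‖) * (α * ‖p - z‖)) := by ring
      _ ≤ M * M * (4 * 4) := by gcongr
      _ = 16 * M ^ 2 := by ring
  · right
    have hσ_eq : σ = α / (4 * M) * ‖G y‖ := min_eq_right hcase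
    have h1 : 2 * μ * (f z - f y) ≤ ‖G y‖ ^ 2 :=
      two_mul_le_norm_sq_of_strong_tangent (d := z - y) hμ (by linarith)
    have h2 : √2 * √μ * √(f z - f y) ≤ ‖G y‖ := by
      rw [← Real.sqrt_mul (by norm_num), ← Real.sqrt_mul (by positivity)]
      exact Real.sqrt_le_iff.2 ⟨norm_nonneg _, h1⟩
    have h3 : α * √2 * √μ / (8 * M) * ((f z - f y) * √(f z - f y)) ≤ σ / 2 * (f z - f y) := by
      rw [hσ_eq]
      calc α * √2 * √μ / (8 * M) * ((f z - f y) * √(f z - f y))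
          = α / (8 * M) * (√2 * √μ * √(f z - f y)) * (f z - f y) := by ring
        _ ≤ α / (8 * M) * ‖G y‖ * (f z - f y) := by gcongr
        _ = _ := by ring
    linarith

/-- `9 a² / (k + 2)²` absorbs the drop of the recursion `h ↦ h - c h^{3/2}`. -/
theorem nine_div_sq_sub_le_cube {a c n : ℝ} (ha : 0 ≤ a) (hca : 8 ≤ (c * a) ^ 2) (hc : 0 < c)
    (hn : 1 ≤ n) :
    (3 * a / (n + 2)) ^ 2 - (3 * a / (n + 3)) ^ 2 ≤ c * (3 * a / (n + 3)) ^ 3 := by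
  have hca' : 2 ≤ c * a := by nlinarith [mul_nonneg hc.le ha]
  have h1 : (2 * n + 5) * (n + 3) ≤ 3 * (c * a) * (n + 2) ^ 2 := by
    nlinarith [mul_le_mul_of_nonneg_right hca' (sq_nonneg (n + 2))]
  have h2 : (3 * a / (n + 2)) ^ 2 - (3 * a / (n + 3)) ^ 2
      = 9 * a ^ 2 * ((2 * n + 5) * (n + 3)) / ((n + 2) ^ 2 * (n + 3) ^ 3) := by
    field_simp; ring
  have h3 : c * (3 * a / (n + 3)) ^ 3
      = 9 * a ^ 2 * (3 * (c * a) * (n + 2) ^ 2) / ((n + 2) ^ 2 * (n + 3) ^ 3) := by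
    field_simp; ring
  rw [h2, h3]
  gcongr

/-- Decay of a perturbed sequence which either halves or decreases by `c h^{3/2}`. -/
theorem perturbed_recursion_le {h : ℕ → ℝ} {A E c β : ℝ} (hc : 0 < c) (hβ : 0 ≤ β)
    (hE : c * β ^ 3 = 2 * E) (h0 : h 0 ≤ A) (hA : 8 / c ^ 2 ≤ A) (hnn : ∀ k, 0 ≤ h k)
    (hstep : ∀ k, ∃ G, h (k + 1) ≤ G + E ∧
      ((G ≤ h k / 2 ∧ G ≤ 4 / c ^ 2) ∨ G ≤ h k - c * (h k * √(h k)))) :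
    ∀ k : ℕ, 1 ≤ k → h k ≤ 9 / ((k : ℝ) + 2) ^ 2 * A + E + β ^ 2 := by
  have hA0 : 0 ≤ A := le_trans (by positivity) hA
  have hE0 : 0 ≤ E := by
    have : 0 ≤ c * β ^ 3 := by positivity
    linarith
  intro k hk
  induction k, hk using Nat.le_induction with
  | base =>
    obtain ⟨G, hG, hcase⟩ := hstep 0
    have hG0 : G ≤ h 0 := by
      rcases hcase with ⟨h1, -⟩ | h1
      · linarith [hnn 0]
      · have : 0 ≤ c * (h 0 * √(h 0)) := mul_nonneg hc.le (mul_nonneg (hnn 0) (Real.sqrt_nonneg _))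
        linarith
    norm_num at hG ⊢
    nlinarith [sq_nonneg β]
  | succ k hk ih =>
    obtain ⟨G, hG, hcase⟩ := hstep k
    have hk1 : (1 : ℝ) ≤ k := by exact_mod_cast hk
    have hR : ∀ n : ℝ, 9 / n ^ 2 * A = (3 * √A / n) ^ 2 := fun n => by
      rw [div_pow, mul_pow, Real.sq_sqrt hA0]; ring
    suffices hsuff : G ≤ 9 / ((k : ℝ) + 3) ^ 2 * A + β ^ 2 by
      push_cast
      rw [show (k : ℝ) + 1 + 2 = k + 3 by ring]
      linarith
    rcases hcase with ⟨hhalf, hsmall⟩ | hdec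
    · rcases le_or_gt E (β ^ 2) with hEβ | hEβ
      · have h1 : 9 / ((k : ℝ) + 2) ^ 2 * A / 2 ≤ 9 / ((k : ℝ) + 3) ^ 2 * A := by
          rw [mul_div_right_comm]
          refine mul_le_mul_of_nonneg_right ?_ hA0
          rw [div_div, div_le_div_iff₀ (by positivity) (by positivity)]
          nlinarith
        linarith
      · have h1 : 2 ≤ c * β := by
          by_contra! hlt
          nlinarith [mul_le_mul_of_nonneg_right hlt.le (sq_nonneg β)]
        have h2 : 4 / c ^ 2 ≤ β ^ 2 := by
          rw [div_le_iff₀ (by positivity)]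
          nlinarith
        have h3 : 0 ≤ 9 / ((k : ℝ) + 3) ^ 2 * A := by positivity
        linarith
    · rcases le_or_gt (h k) (9 / ((k : ℝ) + 3) ^ 2 * A + β ^ 2) with hle | hgt
      · have : 0 ≤ c * (h k * √(h k)) := mul_nonneg hc.le (mul_nonneg (hnn k) (Real.sqrt_nonneg _))
        linarith
      · rw [hR] at hgt ih ⊢
        have hdrop := nine_div_sq_sub_le_cube (c := c) (Real.sqrt_nonneg A)
          (by
            rw [mul_pow, Real.sq_sqrt hA0]
            rw [div_le_iff₀ (by positivity)] at hA
            linarith) hc hk1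
        set r := 3 * √A / ((k : ℝ) + 3)
        have hr0 : 0 ≤ r := by positivity
        have hw : √(h k) ^ 2 = h k := Real.sq_sqrt (hnn k)
        set w := √(h k)
        have hw0 : 0 ≤ w := Real.sqrt_nonneg _
        have hrw : r ≤ w := by
          apply le_of_sq_le_sq _ hw0
          nlinarith [sq_nonneg β]
        have hβw : β ≤ w := by
          apply le_of_sq_le_sq _ hw0
          nlinarith [sq_nonneg r]
        have hcube : r ^ 3 + β ^ 3 ≤ h k * w := by
          calc r ^ 3 + β ^ 3 = r ^ 2 * r + β ^ 2 * β := by ring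
            _ ≤ r ^ 2 * w + β ^ 2 * w := by gcongr
            _ = (r ^ 2 + β ^ 2) * w := by ring
            _ ≤ h k * w := by gcongr
        have := mul_le_mul_of_nonneg_left hcube hc.le
        linarith

/-- A Lipschitz cross-dependence of the partial gradient bounds the mixed second difference. -/
theorem mixed_difference_le {E F : Type*} [NormedAddCommGroup E] [InnerProductSpace ℝ E]
    [CompleteSpace E] {L : E → F → ℝ} {X : Set E} {y z : F} {C : ℝ} (hX : Convex ℝ X)
    (hy : Differentiable ℝ fun x => L x y) (hz : Differentiable ℝ fun x => L x z)
    (hC : ∀ x ∈ X, ‖gradX L x z - gradX L x y‖ ≤ C) {x x' : E} (hx : x ∈ X) (hx' : x' ∈ X) :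
    (L x' z - L x' y) - (L x z - L x y) ≤ C * ‖x' - x‖ := by
  have hderiv : ∀ u ∈ X, HasFDerivWithinAt (fun x => L x z - L x y)
      (InnerProductSpace.toDual ℝ E (gradX L u z - gradX L u y)) X u := fun u _ => by
    rw [map_sub]
    exact ((hz u).hasGradientAt.hasFDerivAt.sub (hy u).hasGradientAt.hasFDerivAt).hasFDerivWithinAt
  have h := hX.norm_image_sub_le_of_norm_hasFDerivWithin_le hderiv
    (fun u hu => by rw [LinearIsometryEquiv.norm_map]; exact hC u hu) hx hx'
  exact (Real.le_norm_self _).trans h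

/-- Gradient of the regularized function in the dual variable. -/
theorem hasGradientAt_Lreg {E F : Type*} [NormedAddCommGroup F] [InnerProductSpace ℝ F]
    [CompleteSpace F] {L : E → F → ℝ} {x : E} (hL : Differentiable ℝ (L x)) (μ : ℝ) (y₀ y : F) :
    HasGradientAt (Lreg L μ y₀ x) (gradY L x y - μ • (y - y₀)) y := by
  have h1 : HasFDerivAt (L x) (InnerProductSpace.toDual ℝ F (gradY L x y)) y :=
    (hL y).hasGradientAt.hasFDerivAt
  have h2 := (((hasFDerivAt_id y).sub_const y₀).norm_sq).const_mul (μ / 2)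
  rw [hasGradientAt_iff_hasFDerivAt]
  refine (h1.sub h2).congr_fderiv ?_
  ext v
  simp
  ring

/-- Strong concavity of the regularized function in the dual variable. -/
theorem Lreg_le_add_inner {E F : Type*} [NormedAddCommGroup F] [InnerProductSpace ℝ F]
    [CompleteSpace F] {L : E → F → ℝ} {x : E} (hL : Differentiable ℝ (L x))
    (hconc : ConcaveOn ℝ Set.univ (L x)) (μ : ℝ) (y₀ y z : F) :
    Lreg L μ y₀ x z ≤ Lreg L μ y₀ x y + ⟪gradY L x y - μ • (y - y₀), z - y⟫
      - μ / 2 * ‖z - y‖ ^ 2 := by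
  have h1 : L x z ≤ L x y + ⟪gradY L x y, z - y⟫ :=
    hconc.le_add_inner_of_hasGradientAt (hL y).hasGradientAt z
  have h2 : ‖z - y₀‖ ^ 2 = ‖z - y‖ ^ 2 + 2 * ⟪z - y, y - y₀⟫ + ‖y - y₀‖ ^ 2 := by
    rw [← norm_add_sq_real, sub_add_sub_cancel]
  simp only [Lreg]
  rw [inner_sub_left, real_inner_smul_left, h2, real_inner_comm (z - y) (y - y₀)]
  linarith

/-- along the R-PDCG iterates, for every `k ≥ 1`,
`H(x_k,y_k) ≤ (9/(k+2)²)·max{H(x₀,y₀), 256(L_yy+μ)²/(α²μ)} + E(τ)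
  + (8√2(L_yy+μ)E(τ)/(α√μ))^{2/3}` with `E(τ) = L_yx τ D_Y D_X + 2 L_xx τ² D_X²`. -/
theorem stmt_10 {E F : Type*}
    [NormedAddCommGroup E] [InnerProductSpace ℝ E] [FiniteDimensional ℝ E]
    [NormedAddCommGroup F] [InnerProductSpace ℝ F] [FiniteDimensional ℝ F]
    (X : Set E) (Y : Set F)
    (hXne : X.Nonempty) (hXconv : Convex ℝ X) (hXcomp : IsCompact X)
    (hYne : Y.Nonempty) (hYconv : Convex ℝ Y) (hYcomp : IsCompact Y)
    (L : E → F → ℝ) (hLdiff : Differentiable ℝ (fun p : E × F => L p.1 p.2))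
    (Lxx Lyy Lyx : ℝ) (hLxx : 0 ≤ Lxx) (hLyy : 0 ≤ Lyy) (hLyx : 0 < Lyx)
    (hlipx : ∀ x ∈ X, ∀ x' ∈ X, ∀ y ∈ Y, ∀ y' ∈ Y,
      ‖gradX L x y - gradX L x' y'‖ ≤ Lxx * ‖x - x'‖ + Lyx * ‖y - y'‖)
    (hlipy : ∀ x ∈ X, ∀ x' ∈ X, ∀ y ∈ Y, ∀ y' ∈ Y,
      ‖gradY L x y - gradY L x' y'‖ ≤ Lyx * ‖x - x'‖ + Lyy * ‖y - y'‖)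
    (hconc : ∀ x ∈ X, ConcaveOn ℝ Set.univ (L x))
    (α : ℝ) (hα : 0 < α)
    (hYsc : ∀ u ∈ Y, ∀ v ∈ Y, ∀ γ ∈ Set.Icc (0 : ℝ) 1, ∀ w : F, ‖w‖ = 1 →
      γ • u + (1 - γ) • v + (γ * (1 - γ) * (α / 2) * ‖u - v‖ ^ 2) • w ∈ Y)
    (μ τ : ℝ) (hμ : 0 < μ) (hτ : τ ∈ Set.Ioc (0 : ℝ) 1)
    (xseq : ℕ → E) (yseq : ℕ → F) (s : ℕ → E) (p : ℕ → F)
    (hx0 : xseq 0 ∈ X) (hy0 : yseq 0 ∈ Y)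
    (ystar : E → F)
    (hystar : ∀ x ∈ X, ystar x ∈ Y ∧
      ∀ y ∈ Y, Lreg L μ (yseq 0) x y ≤ Lreg L μ (yseq 0) x (ystar x))
    (hs : ∀ k : ℕ, s k ∈ X ∧ ∀ x ∈ X,
      ⟪gradX L (xseq k) (yseq k), s k⟫ ≤ ⟪gradX L (xseq k) (yseq k), x⟫)
    (hxrec : ∀ k : ℕ, xseq (k + 1) = τ • s k + (1 - τ) • xseq k)
    (hp : ∀ k : ℕ, p k ∈ Y ∧ ∀ y ∈ Y,
      ⟪gradY L (xseq k) (yseq k) - μ • (yseq k - yseq 0), y⟫ ≤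
        ⟪gradY L (xseq k) (yseq k) - μ • (yseq k - yseq 0), p k⟫)
    (hyrec : ∀ k : ℕ, yseq (k + 1) =
      (min 1 (α / (4 * (Lyy + μ)) *
          ‖gradY L (xseq k) (yseq k) - μ • (yseq k - yseq 0)‖)) • p k
      + (1 - min 1 (α / (4 * (Lyy + μ)) *
          ‖gradY L (xseq k) (yseq k) - μ • (yseq k - yseq 0)‖)) • yseq k) :
    ∀ k : ℕ, 1 ≤ k →
      Lreg L μ (yseq 0) (xseq k) (ystar (xseq k)) - Lreg L μ (yseq 0) (xseq k) (yseq k) ≤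
        9 / ((k : ℝ) + 2) ^ 2 *
          max (Lreg L μ (yseq 0) (xseq 0) (ystar (xseq 0))
                - Lreg L μ (yseq 0) (xseq 0) (yseq 0))
              (256 * (Lyy + μ) ^ 2 / (α ^ 2 * μ))
        + (Lyx * τ * Metric.diam Y * Metric.diam X + 2 * Lxx * τ ^ 2 * Metric.diam X ^ 2)
        + (8 * Real.sqrt 2 * (Lyy + μ) *
            (Lyx * τ * Metric.diam Y * Metric.diam X
              + 2 * Lxx * τ ^ 2 * Metric.diam X ^ 2) /
            (α * Real.sqrt μ)) ^ ((2 : ℝ) / 3) := by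
  have hM : 0 < Lyy + μ := by linarith
  have hLx : ∀ x, Differentiable ℝ (L x) := fun x =>
    hLdiff.comp ((differentiable_const x).prodMk differentiable_id)
  have hLy : ∀ y, Differentiable ℝ (fun x => L x y) := fun y =>
    hLdiff.comp (differentiable_id.prodMk (differentiable_const y))
  have hxmem : ∀ k, xseq k ∈ X := by
    intro k
    induction k with
    | zero => exact hx0
    | succ k ih =>
      rw [hxrec]
      exact hXconv (hs k).1 ih hτ.1.le (by linarith [hτ.2]) (by ring)
  have hdual : ∀ k, yseq k ∈ Y → _ := fun k hyk =>
    condGrad_step_of_stronglyConvex (M := Lyy + μ) (f := Lreg L μ (yseq 0) (xseq k))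
      (G := fun y => gradY L (xseq k) y - μ • (y - yseq 0)) (y := yseq k) (z := ystar (xseq k))
      (p := p k) (y' := yseq (k + 1)) hYconv hYsc hμ (by linarith) hα
      (fun y => hasGradientAt_Lreg (hLx _) μ _ y)
      (fun y z => Lreg_le_add_inner (hLx _) (hconc _ (hxmem k)) μ _ y z)
      (fun y hy z hz => by
        have h1 := hlipy _ (hxmem k) _ (hxmem k) y hy z hz
        rw [sub_self, norm_zero, mul_zero, zero_add] at h1
        have h2 : gradY L (xseq k) y - μ • (y - yseq 0)
            - (gradY L (xseq k) z - μ • (z - yseq 0))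
            = (gradY L (xseq k) y - gradY L (xseq k) z) - μ • (y - z) := by module
        rw [h2]
        refine (norm_sub_le _ _).trans ?_
        rw [norm_smul, Real.norm_of_nonneg hμ.le]
        linarith)
      hyk (hystar _ (hxmem k)).1 (hystar _ (hxmem k)).2 (hp k).1 (hp k).2 (hyrec k)
  have hymem : ∀ k, yseq k ∈ Y := by
    intro k
    induction k with
    | zero => exact hy0
    | succ k ih => exact (hdual k ih).1
  set e := Lyx * τ * Metric.diam Y * Metric.diam X + 2 * Lxx * τ ^ 2 * Metric.diam X ^ 2
  have hτ0 := hτ.1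
  have hdX : 0 ≤ Metric.diam X := Metric.diam_nonneg
  have hdY : 0 ≤ Metric.diam Y := Metric.diam_nonneg
  have he0 : 0 ≤ e := by positivity
  have hdrift : ∀ k,
      Lreg L μ (yseq 0) (xseq (k + 1)) (ystar (xseq (k + 1)))
        - Lreg L μ (yseq 0) (xseq (k + 1)) (yseq (k + 1))
      ≤ (Lreg L μ (yseq 0) (xseq k) (ystar (xseq k))
        - Lreg L μ (yseq 0) (xseq k) (yseq (k + 1))) + e := by
    intro k
    have hz := (hystar _ (hxmem (k + 1))).1
    have h1 := (hystar _ (hxmem k)).2 _ hz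
    have h2 := mixed_difference_le (L := L) (y := yseq (k + 1)) (z := ystar (xseq (k + 1)))
      (C := Lyx * Metric.diam Y) hXconv (hLy _) (hLy _)
      (fun x hx => by
        have h3 := hlipx x hx x hx _ hz _ (hymem (k + 1))
        rw [sub_self, norm_zero, mul_zero, zero_add] at h3
        refine h3.trans (mul_le_mul_of_nonneg_left ?_ hLyx.le)
        rw [← dist_eq_norm]
        exact Metric.dist_le_diam_of_mem hYcomp.isBounded hz (hymem (k + 1)))
      (hxmem k) (hxmem (k + 1))
    have h4 : ‖xseq (k + 1) - xseq k‖ ≤ τ * Metric.diam X := by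
      have h5 : xseq (k + 1) - xseq k = τ • (s k - xseq k) := by rw [hxrec]; module
      rw [h5, norm_smul, Real.norm_of_nonneg hτ0.le, ← dist_eq_norm]
      exact mul_le_mul_of_nonneg_left
        (Metric.dist_le_diam_of_mem hXcomp.isBounded (hs k).1 (hxmem k)) hτ0.le
    have h6 := mul_le_mul_of_nonneg_left h4 (mul_nonneg hLyx.le hdY)
    have h7 : 0 ≤ 2 * Lxx * τ ^ 2 * Metric.diam X ^ 2 := by positivity
    simp only [Lreg] at h1 ⊢
    linarith
  have hs2 : √2 ^ 2 = 2 := Real.sq_sqrt (by norm_num)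
  have hsμ : √μ ^ 2 = μ := Real.sq_sqrt hμ.le
  have hsμ0 : 0 < √μ := Real.sqrt_pos.2 hμ
  set T := 8 * √2 * (Lyy + μ) * e / (α * √μ) with hT
  have hT0 : 0 ≤ T := by positivity
  have hβ3 : (T ^ ((1 : ℝ) / 3)) ^ 3 = T := by
    rw [← Real.rpow_natCast, ← Real.rpow_mul hT0]; norm_num
  have hβ2 : (T ^ ((1 : ℝ) / 3)) ^ 2 = T ^ ((2 : ℝ) / 3) := by
    rw [← Real.rpow_natCast, ← Real.rpow_mul hT0]; norm_num
  have hc2 : (α * √2 * √μ / (8 * (Lyy + μ))) ^ 2 = α ^ 2 * μ / (32 * (Lyy + μ) ^ 2) := by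
    rw [div_pow, mul_pow, mul_pow, hs2, hsμ]
    field_simp
    norm_num
  intro k hk
  rw [← hβ2]
  refine perturbed_recursion_le
    (h := fun k => Lreg L μ (yseq 0) (xseq k) (ystar (xseq k))
      - Lreg L μ (yseq 0) (xseq k) (yseq k))
    (c := α * √2 * √μ / (8 * (Lyy + μ))) (by positivity) (by positivity) ?_ (le_max_left _ _) ?_
    (fun k => sub_nonneg.2 ((hystar _ (hxmem k)).2 _ (hymem k))) (fun k => ?_) k hk
  · rw [hβ3, hT]
    field_simp
    rw [hs2, mul_comm]
  · refine le_trans (le_of_eq ?_) (le_max_right _ _)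
    rw [hc2]
    field_simp
    norm_num
  · refine ⟨_, hdrift k, (hdual k (hymem k)).2.imp (fun h => ⟨h.1, h.2.trans ?_⟩) id⟩
    rw [hc2, div_div_eq_mul_div, ← mul_assoc]
    gcongr
    norm_num
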